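/- Let σ be an operator connection whose representing function f is unbounded and satisfies f(0) = 0, so that for each invertible A > 0 and each B ≥ 0 the equation A σ X = B has the unique positive solution X(A,B) = A^{1/2} f^{-1}(A^{-1/2} B A^{-1/2}) A^{1/2}. Then the solution map is separately sequentially continuous in the strong operator topology on norm-bounded sets: for fixed invertible A > 0, if (Bₙ) is a norm-bounded sequence of positive operators converging strongly to B, then X(A,Bₙ) converges strongly to X(A,B); and for fixed B ≥ 0, if (Aₙ) is a sequence of positive operators with εI ≤ Aₙ ≤ cI for some constants 0 < ε ≤ c converging strongly to A, then X(Aₙ,B) converges strongly to X(A,B). -/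

import Mathlib

open ContinuousLinearMap Filter Topology MeasureTheory
open scoped NNReal ENNReal

set_option synthInstance.maxHeartbeats 1000000
set_option maxHeartbeats 1000000

noncomputable section

variable {H : Type} [NormedAddCommGroup H] [InnerProductSpace ℂ H] [CompleteSpace H]

/-- Convergence of a sequence of bounded operators in the strong operator topology. -/
def SOTTendsto (A : ℕ → H →L[ℂ] H) (A₀ : H →L[ℂ] H) : Prop :=
  ∀ x : H, Tendsto (fun n => A n x) atTop (𝓝 (A₀ x))

/-- A Kubo–Ando operator connection on the positive bounded operators on `H`:
a binary operation on positive operators (hence positivity of the output) satisfying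
monotonicity (M1), the transformer inequality (M2) and continuity from above (M3). -/
structure IsConnection (σ : (H →L[ℂ] H) → (H →L[ℂ] H) → (H →L[ℂ] H)) : Prop where
  isPositive : ∀ A B : H →L[ℂ] H, A.IsPositive → B.IsPositive → (σ A B).IsPositive
  mono : ∀ A B C D : H →L[ℂ] H, A.IsPositive → B.IsPositive → C.IsPositive → D.IsPositive →
    A ≤ C → B ≤ D → σ A B ≤ σ C D
  transformer : ∀ A B C : H →L[ℂ] H, A.IsPositive → B.IsPositive → C.IsPositive →
    C * σ A B * C ≤ σ (C * A * C) (C * B * C)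
  contFromAbove : ∀ (A B : ℕ → H →L[ℂ] H) (A₀ B₀ : H →L[ℂ] H),
    (∀ n, (A n).IsPositive) → (∀ n, (B n).IsPositive) → A₀.IsPositive → B₀.IsPositive →
    Antitone A → Antitone B → SOTTendsto A A₀ → SOTTendsto B B₀ →
    Antitone (fun n => σ (A n) (B n)) ∧ SOTTendsto (fun n => σ (A n) (B n)) (σ A₀ B₀)

/-- A function `f : [0,∞) → [0,∞)` is operator monotone if for every complex Hilbert
space `K` and all positive bounded operators `A ≤ B` on `K` one has `f(A) ≤ f(B)`,
where `f` is applied via the continuous functional calculus. -/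
def OperatorMonotone (f : ℝ≥0 → ℝ≥0) : Prop :=
  ∀ (K : Type) [NormedAddCommGroup K] [InnerProductSpace ℂ K] [CompleteSpace K],
    ∀ A B : K →L[ℂ] K, A.IsPositive → B.IsPositive → A ≤ B → cfc f A ≤ cfc f B

/-- `f` is the representing function of the connection `σ`: `f` is operator monotone
and `f(x)·I = I σ (x·I)` for all `x ≥ 0`. -/
def IsRepresentingFunction (σ : (H →L[ℂ] H) → (H →L[ℂ] H) → (H →L[ℂ] H))
    (f : ℝ≥0 → ℝ≥0) : Prop :=
  OperatorMonotone f ∧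
    ∀ x : ℝ≥0, σ 1 ((x : ℝ) • (1 : H →L[ℂ] H)) = (f x : ℝ) • (1 : H →L[ℂ] H)

/-- The kernel `t ↦ 1 !ₜ x = x / ((1-t)x + t)`, with the conventions
`1 !₀ x = 1` for every `x` (in particular `1 !₀ 0 = 1`) and `1 !ₜ 0 = 0` for `t > 0`. -/
def harmKernel (t : ℝ) (x : ℝ≥0) : ℝ≥0∞ :=
  if t = 0 then 1 else ENNReal.ofReal ((x : ℝ) / ((1 - t) * (x : ℝ) + t))

/-- `μ` is the associated (finite Borel) measure of a connection with representing
function `f`: `μ` is supported on `[0,1]` and `f(x) = ∫_{[0,1]} (1 !ₜ x) dμ(t)`. -/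
def IsAssociatedMeasure (f : ℝ≥0 → ℝ≥0) (μ : Measure ℝ) : Prop :=
  μ (Set.Icc (0:ℝ) 1)ᶜ = 0 ∧
    ∀ x : ℝ≥0, (f x : ℝ≥0∞) = ∫⁻ t in Set.Icc (0:ℝ) 1, harmKernel t x ∂μ

/-- `g` is the transpose of `f`: `g(x) = x·f(1/x)` for `x > 0`, extended to `0` by
continuity, i.e. `g(0) = lim_{x→0⁺} x·f(1/x)`. -/
def IsTransposeFunction (g f : ℝ≥0 → ℝ≥0) : Prop :=
  (∀ x : ℝ≥0, x ≠ 0 → g x = x * f x⁻¹) ∧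
    Tendsto (fun x : ℝ≥0 => x * f x⁻¹) (𝓝[>] (0 : ℝ≥0)) (𝓝 (g 0))

/-- The solution map `(A, B) ↦ A^{1/2} f⁻¹(A^{-1/2} B A^{-1/2}) A^{1/2}` for the
operator equation `A σ X = B`. -/
def solMap (f : ℝ≥0 → ℝ≥0) (A B : H →L[ℂ] H) : H →L[ℂ] H :=
  CFC.sqrt A *
      cfc (Function.invFun f)
        (CFC.rpow A (-(1/2) : ℝ) * B * CFC.rpow A (-(1/2) : ℝ)) *
    CFC.sqrt A

theorem exists_polynomial_norm_cfc_sub_le [Nontrivial H] {g : ℝ → ℝ} (hg : Continuous g) (M : ℝ)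
    {ε : ℝ} (hε : 0 < ε) :
    ∃ p : Polynomial ℝ, ∀ X : H →L[ℂ] H, IsSelfAdjoint X → ‖X‖ ≤ M →
      ‖cfc g X - Polynomial.aeval X p‖ ≤ ε := by
  obtain ⟨p, hp⟩ := exists_polynomial_near_of_continuousOn (-M) M g hg.continuousOn ε hε
  refine ⟨p, fun X hX hXM => ?_⟩
  rw [← cfc_polynomial p X hX, ← cfc_sub g _ X hg.continuousOn p.continuous.continuousOn]
  refine norm_cfc_le hε.le fun x hx => ?_
  have hxM := abs_le.1 ((spectrum.norm_le_norm_of_mem hx).trans hXM)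
  rw [norm_sub_rev, Real.norm_eq_abs]
  exact (hp x ⟨hxM.1, hxM.2⟩).le

omit [CompleteSpace H] in
theorem aeval_mul_eq_aeval_mul {X Y P : H →L[ℂ] H} (hX : Commute X P)
    (hXY : X * P = Y * P) (p : Polynomial ℝ) :
    Polynomial.aeval X p * P = Polynomial.aeval Y p * P := by
  have hpow : ∀ n : ℕ, X ^ n * P = Y ^ n * P := by
    intro n
    induction n with
    | zero => simp
    | succ n ih =>
      calc X ^ (n + 1) * P = X ^ n * P * X := by rw [pow_succ, mul_assoc, hX.eq, mul_assoc]
        _ = Y ^ n * (X * P) := by rw [ih, mul_assoc, hX.eq]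
        _ = Y ^ (n + 1) * P := by rw [hXY, pow_succ, mul_assoc]
  induction p using Polynomial.induction_on' with
  | add p q hp hq => simp only [map_add, add_mul, hp, hq]
  | monomial n c => simp only [Polynomial.aeval_monomial, mul_assoc, hpow]

theorem cfc_mul_eq_cfc_mul [Nontrivial H] {g : ℝ → ℝ} (hg : Continuous g) {X Y P : H →L[ℂ] H}
    (hX : IsSelfAdjoint X) (hY : IsSelfAdjoint Y) (hXP : Commute X P) (hXY : X * P = Y * P) :
    cfc g X * P = cfc g Y * P := by
  rw [← sub_eq_zero, ← norm_le_zero_iff]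
  refine le_of_forall_pos_le_add fun ε hε => ?_
  obtain ⟨p, hp⟩ := exists_polynomial_norm_cfc_sub_le (H := H) hg (max ‖X‖ ‖Y‖)
    (ε := ε / (2 * (‖P‖ + 1))) (by positivity)
  have h1 := hp X hX (le_max_left _ _)
  have h2 := hp Y hY (le_max_right _ _)
  have key : cfc g X * P - cfc g Y * P =
      (cfc g X - Polynomial.aeval X p) * P - (cfc g Y - Polynomial.aeval Y p) * P := by
    rw [sub_mul, sub_mul, aeval_mul_eq_aeval_mul hXP hXY p]
    abel
  rw [key, zero_add]
  calc _ ≤ ‖(cfc g X - Polynomial.aeval X p) * P‖ + ‖(cfc g Y - Polynomial.aeval Y p) * P‖ :=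
        norm_sub_le _ _
    _ ≤ ε / (2 * (‖P‖ + 1)) * ‖P‖ + ε / (2 * (‖P‖ + 1)) * ‖P‖ := by
        gcongr <;> refine (norm_mul_le _ _).trans ?_ <;> gcongr
    _ = ε * (‖P‖ / (‖P‖ + 1)) := by field_simp; ring
    _ ≤ ε := by
        refine mul_le_of_le_one_right hε.le ?_
        rw [div_le_one (by positivity)]
        linarith

theorem smul_le_conj_cfc_le_smul [Nontrivial H] {g : ℝ → ℝ} (hg : Continuous g) (hmono : Monotone g)
    {X P : H →L[ℂ] H} (hX : IsSelfAdjoint X) (hP : IsStarProjection P) (hXP : Commute X P)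
    {a b : ℝ} (hab : a ≤ b) (ha : a • P ≤ P * X * P) (hb : P * X * P ≤ b • P) :
    g a • P ≤ P * cfc g X * P ∧ P * cfc g X * P ≤ g b • P := by
  have hPP : P * P = P := hP.isIdempotentElem
  have hPs : IsSelfAdjoint P := hP.isSelfAdjoint
  have hP0 : 0 ≤ P := hP.nonneg
  have hQ0 : 0 ≤ 1 - P := hP.one_sub.nonneg
  set Y := P * X * P + a • (1 - P) with hYdef
  have hsplit : ∀ c : ℝ, algebraMap ℝ (H →L[ℂ] H) c = c • P + c • (1 - P) := by
    intro c
    rw [← smul_add, Algebra.algebraMap_eq_smul_one]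
    congr 1
    abel
  have haY : algebraMap ℝ (H →L[ℂ] H) a ≤ Y := by
    rw [hsplit]
    exact add_le_add ha le_rfl
  have hYb : Y ≤ algebraMap ℝ (H →L[ℂ] H) b := by
    rw [hsplit]
    exact add_le_add hb (smul_le_smul_of_nonneg_right hab hQ0)
  have hYs : IsSelfAdjoint Y := by
    refine IsSelfAdjoint.add (hX.conjugate_self hPs) ?_
    exact (IsSelfAdjoint.all a).smul hP.one_sub.isSelfAdjoint
  have hXY : X * P = Y * P := by
    rw [hYdef, add_mul, smul_mul_assoc, hP.one_sub_mul_self, smul_zero, add_zero, mul_assoc, hPP,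
      ← hXP.eq, mul_assoc, hPP]
  have hc : P * cfc g X * P = P * cfc g Y * P := by
    rw [mul_assoc, cfc_mul_eq_cfc_mul hg hX hYs hXP hXY, mul_assoc]
  have hlow : g a • (1 : H →L[ℂ] H) ≤ cfc g Y := by
    rw [← Algebra.algebraMap_eq_smul_one, algebraMap_le_cfc_iff g (g a) Y hg.continuousOn hYs]
    intro x hx
    exact hmono ((algebraMap_le_iff_le_spectrum hYs).1 haY x hx)
  have hup : cfc g Y ≤ g b • (1 : H →L[ℂ] H) := by
    rw [← Algebra.algebraMap_eq_smul_one, cfc_le_algebraMap_iff g (g b) Y hg.continuousOn hYs]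
    intro x hx
    exact hmono ((le_algebraMap_iff_spectrum_le hYs).1 hYb x hx)
  rw [hc]
  constructor
  · simpa [hPP] using hPs.conjugate_le_conjugate hlow
  · simpa [hPP] using hPs.conjugate_le_conjugate hup

/-- A selfadjoint operator is split at the level `c` by a projection which commutes with every
selfadjoint operator commuting with it. -/
theorem exists_spectral_projection {X : H →L[ℂ] H} (hX : IsSelfAdjoint X) (c : ℝ) :
    ∃ P : H →L[ℂ] H, IsStarProjection P ∧
      (∀ Y : H →L[ℂ] H, IsSelfAdjoint Y → Commute Y X → Commute Y P) ∧
      P * X * P ≤ c • P ∧ c • (1 - P) ≤ (1 - P) * X * (1 - P) := by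
  set Z := X - c • (1 : H →L[ℂ] H) with hZ
  have hZs : IsSelfAdjoint Z := hX.sub ((IsSelfAdjoint.all c).smul (IsSelfAdjoint.one _))
  set U : Submodule ℂ H := LinearMap.ker ((Z⁺ : H →L[ℂ] H) : H →ₗ[ℂ] H) with hU
  have hmem : ∀ v, v ∈ U ↔ Z⁺ v = 0 := fun v => by simp [hU]
  have : CompleteSpace U := (ContinuousLinearMap.isClosed_ker (Z⁺)).completeSpace_coe
  set P := U.starProjection with hPdef
  have hP : IsStarProjection P := isStarProjection_starProjection
  have hPs : IsSelfAdjoint P := hP.isSelfAdjoint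
  have hZP : Z⁺ * P = 0 := by
    ext v
    exact (hmem _).1 (U.starProjection_apply_mem v)
  have hfix : ∀ Y : H →L[ℂ] H, Z⁺ * Y = 0 → P * Y = Y := by
    intro Y hY
    ext v
    refine Submodule.starProjection_eq_self_iff.2 ((hmem _).2 ?_)
    exact DFunLike.congr_fun hY v
  have hPN : P * Z⁻ = Z⁻ := hfix _ (CFC.posPart_mul_negPart Z)
  have hQN : (1 - P) * Z⁻ = 0 := by rw [sub_mul, hPN, one_mul, sub_self]
  have hZdec : Z⁺ - Z⁻ = Z := CFC.posPart_sub_negPart Z hZs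
  have hXdec : X = Z⁺ - Z⁻ + c • 1 := by rw [hZdec, hZ]; abel
  refine ⟨P, hP, ?_, ?_, ?_⟩
  · intro Y hYs hYX
    have hYZ : Commute Z Y := by
      rw [hZ]
      exact (hYX.symm).sub_left ((Commute.one_left Y).smul_left c)
    have hYZp : Commute (Z⁺) Y := by
      rw [CFC.posPart_def]
      exact Commute.cfcₙ hYZ (by rwa [hZs.star_eq]) _
    have h1 : P * (Y * P) = Y * P := by
      refine hfix _ ?_
      rw [← mul_assoc, hYZp.eq, mul_assoc, hZP, mul_zero]
    have h2 := congrArg star h1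
    simp only [star_mul, hPs.star_eq, hYs.star_eq] at h2
    rw [Commute, SemiconjBy, ← h1, ← h2, mul_assoc]
  · have : P * X * P = c • P - P * Z⁻ * P := by
      conv_lhs => rw [hXdec]
      rw [mul_assoc, add_mul, sub_mul, hZP, smul_mul_assoc, one_mul, mul_add, mul_smul_comm,
        show P * P = P from hP.isIdempotentElem, zero_sub, mul_neg, ← mul_assoc]
      abel
    rw [this]
    exact sub_le_self _ (hPs.conjugate_nonneg (CFC.negPart_nonneg Z))
  · have : (1 - P) * X * (1 - P) = c • (1 - P) + (1 - P) * Z⁺ * (1 - P) := by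
      conv_lhs => rw [hXdec]
      rw [mul_add (1 - P), mul_sub (1 - P) (Z⁺), hQN, sub_zero, add_mul, mul_smul_comm, mul_one, smul_mul_assoc,
        show (1 - P) * (1 - P) = 1 - P from hP.one_sub.isIdempotentElem, add_comm]
    rw [this]
    exact le_add_of_nonneg_right (hP.one_sub.isSelfAdjoint.conjugate_nonneg (CFC.posPart_nonneg Z))

omit [CompleteSpace H] in
theorem conj_mul_eq {W Q S : H →L[ℂ] H} (hS : IsIdempotentElem S) (hQS : Commute Q S)
    (hWS : Commute S W) : (Q * S) * W * (Q * S) = Q * W * Q * S := by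
  calc (Q * S) * W * (Q * S) = Q * (S * W) * (S * Q) := by
        rw [hQS.eq]
        simp only [mul_assoc]
        rw [hQS.left_comm]
    _ = Q * W * (S * S) * Q := by rw [hWS.eq]; simp only [mul_assoc]
    _ = Q * W * Q * S := by rw [hS.eq, mul_assoc, ← hQS.eq, ← mul_assoc]

theorem conj_le_of_split {W : H →L[ℂ] H} {P Q : H →L[ℂ] H} (hP : IsStarProjection P)
    (hPQ : Commute Q P) (hWP : Commute P W) {ε : ℝ}
    (h₁ : (Q * P) * W * (Q * P) ≤ ε • (Q * P))
    (h₂ : (Q * (1 - P)) * W * (Q * (1 - P)) ≤ ε • (Q * (1 - P))) :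
    Q * W * Q ≤ ε • Q := by
  rw [conj_mul_eq hP.isIdempotentElem hPQ hWP] at h₁
  rw [conj_mul_eq hP.one_sub.isIdempotentElem ((Commute.one_right Q).sub_right hPQ)
    ((Commute.one_left W).sub_left hWP)] at h₂
  have h := add_le_add h₁ h₂
  rwa [← mul_add, ← smul_add, ← mul_add, add_sub_cancel, mul_one, mul_one] at h

/-- Divide and conquer on the spectrum: the quadratic form of `W` is bounded on the spectral
subspaces of `X` as soon as it is bounded on those of small spread. -/
theorem conj_le_smul_of_small {X W : H →L[ℂ] H} (hX : IsSelfAdjoint X) {ε δ : ℝ} (hδ : 0 ≤ δ)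
    (hW : ∀ P : H →L[ℂ] H, IsStarProjection P → Commute P X → Commute P W)
    {m M : ℝ}
    (hsmall : ∀ Q : H →L[ℂ] H, IsStarProjection Q → Commute Q X → ∀ a b : ℝ, m ≤ a → a ≤ b →
      b ≤ M → b - a ≤ δ → a • Q ≤ Q * X * Q → Q * X * Q ≤ b • Q → Q * W * Q ≤ ε • Q)
    (n : ℕ) : ∀ Q : H →L[ℂ] H, IsStarProjection Q → Commute Q X → ∀ a b : ℝ, m ≤ a → a ≤ b →
      b ≤ M → b - a ≤ (n + 1) * δ → a • Q ≤ Q * X * Q → Q * X * Q ≤ b • Q → Q * W * Q ≤ ε • Q := by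
  induction n with
  | zero =>
    intro Q hQ hQX a b hma hab hbM hlen
    exact hsmall Q hQ hQX a b hma hab hbM (by simpa using hlen)
  | succ n ih =>
    intro Q hQ hQX a b hma hab hbM hlen ha hb
    by_cases hba : b - a ≤ δ
    · exact hsmall Q hQ hQX a b hma hab hbM hba ha hb
    push Not at hba
    obtain ⟨P, hP, hcomm, hlow, hup⟩ := exists_spectral_projection hX (b - δ)
    have hXP : Commute X P := hcomm X hX (Commute.refl X)
    have hQP : Commute Q P := hcomm Q hQ.isSelfAdjoint hQX
    have hQQ : Q * Q = Q := hQ.isIdempotentElem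
    have hR := hP.one_sub
    have hQR : Commute Q (1 - P) := (Commute.one_right Q).sub_right hQP
    have hXR : Commute X (1 - P) := (Commute.one_right X).sub_right hXP
    have e : ∀ S : H →L[ℂ] H, IsStarProjection S → Commute Q S → Commute X S →
        (Q * S) * X * (Q * S) = S * (Q * X * Q) * S ∧
        (Q * S) * X * (Q * S) = Q * (S * X * S) * Q ∧ S * Q * S = Q * S ∧ Q * S * Q = Q * S := by
      intro S hS hQS hXS
      have hSS : S * S = S := hS.isIdempotentElem
      refine ⟨?_, ?_, ?_, ?_⟩
      · nth_rw 1 [hQS.eq]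
        simp only [mul_assoc]
      · nth_rw 2 [hQS.eq]
        simp only [mul_assoc]
      · rw [mul_assoc, hQS.eq, ← mul_assoc, hSS]
      · rw [mul_assoc, ← hQS.eq, ← mul_assoc, hQQ]
    obtain ⟨p₁, p₂, p₃, p₄⟩ := e P hP hQP hXP
    obtain ⟨r₁, r₂, r₃, r₄⟩ := e _ hR hQR hXR
    refine conj_le_of_split hP hQP (hW P hP hXP.symm) ?_ ?_
    · refine ih (Q * P) (hQ.mul hP hQP) (hQX.mul_left hXP.symm) a (b - δ) hma (by linarith)
        (by linarith) (by push_cast at hlen; linarith) ?_ ?_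
      · rw [p₁]
        simpa [p₃] using hP.isSelfAdjoint.conjugate_le_conjugate ha
      · rw [p₂]
        simpa [p₄] using hQ.isSelfAdjoint.conjugate_le_conjugate hlow
    · refine hsmall (Q * (1 - P)) (hQ.mul hR hQR) (hQX.mul_left hXR.symm) (b - δ) b (by linarith)
        (by linarith) hbM (by linarith) ?_ ?_
      · rw [r₂]
        simpa only [mul_smul_comm, smul_mul_assoc, r₄]
          using hQ.isSelfAdjoint.conjugate_le_conjugate hup
      · rw [r₁]
        simpa only [mul_smul_comm, smul_mul_assoc, r₃]
          using hR.isSelfAdjoint.conjugate_le_conjugate hb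

theorem smul_one_le_smul_one_iff [Nontrivial H] {a b : ℝ} :
    a • (1 : H →L[ℂ] H) ≤ b • (1 : H →L[ℂ] H) ↔ a ≤ b := by
  rw [← Algebra.algebraMap_eq_smul_one, ← Algebra.algebraMap_eq_smul_one]
  exact algebraMap_le_algebraMap

theorem exists_nonneg_inverse {C : H →L[ℂ] H} (hC : 0 ≤ C) {ε : ℝ} (hε : 0 < ε) :
    ∃ D : H →L[ℂ] H, 0 ≤ D ∧ (C + ε • 1) * D = 1 ∧ D * (C + ε • 1) = 1 := by
  have hE : (0 : H →L[ℂ] H) ≤ ε • 1 := smul_nonneg hε.le zero_le_one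
  have hCε : 0 ≤ C + ε • (1 : H →L[ℂ] H) := add_nonneg hC hE
  have hu : IsUnit (C + ε • (1 : H →L[ℂ] H)) := by
    refine CStarAlgebra.isUnit_of_le (ε • (1 : H →L[ℂ] H)) (le_add_of_nonneg_left hC) ?_
    rw [← Algebra.algebraMap_eq_smul_one]
    refine IsStrictlyPositive.iff_of_unital.2 ⟨?_, ?_⟩
    · rwa [Algebra.algebraMap_eq_smul_one]
    · exact (isUnit_iff_ne_zero.2 hε.ne').map _
  obtain ⟨u, hu⟩ := hu
  have h₁ : (C + ε • 1) * (↑u⁻¹ : H →L[ℂ] H) = 1 := by rw [← hu, Units.mul_inv]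
  have h₂ : (↑u⁻¹ : H →L[ℂ] H) * (C + ε • 1) = 1 := by rw [← hu, Units.inv_mul]
  have hs : IsSelfAdjoint (↑u⁻¹ : H →L[ℂ] H) := by
    have h₃ := congrArg star h₁
    rw [star_mul, (IsSelfAdjoint.of_nonneg hCε).star_eq, star_one] at h₃
    exact left_inv_eq_right_inv h₃ h₁
  refine ⟨_, ?_, h₁, h₂⟩
  have := hs.conjugate_nonneg hCε
  rwa [h₂, one_mul] at this

namespace IsConnection

variable {σ : (H →L[ℂ] H) → (H →L[ℂ] H) → (H →L[ℂ] H)}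

omit [CompleteSpace H] in
theorem nonneg (hσ : IsConnection σ) {A B : H →L[ℂ] H} (hA : 0 ≤ A) (hB : 0 ≤ B) :
    0 ≤ σ A B := by
  rw [nonneg_iff_isPositive] at *
  exact hσ.isPositive A B hA hB

omit [CompleteSpace H] in
theorem apply_le_apply (hσ : IsConnection σ) {A B C D : H →L[ℂ] H} (hA : 0 ≤ A) (hB : 0 ≤ B)
    (hAC : A ≤ C) (hBD : B ≤ D) : σ A B ≤ σ C D := by
  have hC := hA.trans hAC
  have hD := hB.trans hBD
  rw [nonneg_iff_isPositive] at *
  exact hσ.mono A B C D hA hB hC hD hAC hBD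

omit [CompleteSpace H] in
theorem conj_le (hσ : IsConnection σ) {A B C : H →L[ℂ] H} (hA : 0 ≤ A) (hB : 0 ≤ B)
    (hC : 0 ≤ C) : C * σ A B * C ≤ σ (C * A * C) (C * B * C) := by
  rw [nonneg_iff_isPositive] at *
  exact hσ.transformer A B C hA hB hC

/-- The transformer inequality is an equality for invertible operators. -/
theorem conj_eq (hσ : IsConnection σ) {A B C D : H →L[ℂ] H} (hA : 0 ≤ A) (hB : 0 ≤ B)
    (hC : 0 ≤ C) (hD : 0 ≤ D) (hCD : C * D = 1) (hDC : D * C = 1) :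
    C * σ A B * C = σ (C * A * C) (C * B * C) := by
  have hCs := IsSelfAdjoint.of_nonneg hC
  have e : ∀ Y : H →L[ℂ] H, D * (C * Y * C) * D = Y := fun Y => by
    rw [← mul_assoc, ← mul_assoc, hDC, one_mul, mul_assoc, hCD, mul_one]
  have e' : ∀ Y : H →L[ℂ] H, C * (D * Y * D) * C = Y := fun Y => by
    rw [← mul_assoc, ← mul_assoc, hCD, one_mul, mul_assoc, hDC, mul_one]
  refine le_antisymm (hσ.conj_le hA hB hC) ?_
  have h := hσ.conj_le (hCs.conjugate_nonneg hA) (hCs.conjugate_nonneg hB) hD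
  rw [e, e] at h
  simpa only [e'] using hCs.conjugate_le_conjugate h

theorem smul_apply (hσ : IsConnection σ) {A B : H →L[ℂ] H} (hA : 0 ≤ A) (hB : 0 ≤ B) {t : ℝ}
    (ht : 0 < t) : σ (t • A) (t • B) = t • σ A B := by
  have hs : 0 < √t := Real.sqrt_pos.2 ht
  have hss : √t * √t = t := Real.mul_self_sqrt ht.le
  have e : ∀ Y : H →L[ℂ] H, (√t • (1 : H →L[ℂ] H)) * Y * (√t • (1 : H →L[ℂ] H)) = t • Y := by
    intro Y
    rw [smul_mul_assoc, one_mul, mul_smul_comm, mul_one, smul_smul, hss]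
  have h := hσ.conj_eq hA hB (C := √t • 1) (D := (√t)⁻¹ • 1) (smul_nonneg hs.le zero_le_one)
    (smul_nonneg (inv_nonneg.2 hs.le) zero_le_one)
    (by rw [smul_mul_smul_comm, mul_inv_cancel₀ hs.ne', one_mul, one_smul])
    (by rw [smul_mul_smul_comm, inv_mul_cancel₀ hs.ne', one_mul, one_smul])
  rw [e, e, e] at h
  exact h.symm

variable {f : ℝ≥0 → ℝ≥0}

theorem representing_monotone [Nontrivial H] (hσ : IsConnection σ)
    (hf : IsRepresentingFunction σ f) : Monotone f := by
  intro x y hxy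
  have h := hσ.apply_le_apply (A := 1) (B := (x : ℝ) • 1) (C := 1) (D := (y : ℝ) • 1) zero_le_one
    (smul_nonneg x.coe_nonneg zero_le_one) le_rfl (smul_one_le_smul_one_iff.2 hxy)
  rw [hf.2, hf.2, smul_one_le_smul_one_iff] at h
  exact_mod_cast h

theorem mul_representing_le [Nontrivial H] (hσ : IsConnection σ)
    (hf : IsRepresentingFunction σ f) {x y : ℝ≥0} (hy : 0 < y) (hyx : y ≤ x) :
    y * f x ≤ x * f y := by
  have h1 : (0 : H →L[ℂ] H) ≤ 1 := zero_le_one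
  have h := hσ.apply_le_apply (A := (y : ℝ) • 1) (B := ((x : ℝ) * y) • 1) (C := (x : ℝ) • 1)
    (D := ((x : ℝ) * y) • 1) (smul_nonneg y.coe_nonneg h1) (smul_nonneg (by positivity) h1)
    (smul_one_le_smul_one_iff.2 hyx) le_rfl
  have e₁ : ((x : ℝ) * y) • (1 : H →L[ℂ] H) = (y : ℝ) • ((x : ℝ) • 1) := by
    rw [smul_smul, mul_comm]
  nth_rw 1 [e₁] at h
  rw [← smul_smul, hσ.smul_apply h1 (smul_nonneg x.coe_nonneg h1) (by exact_mod_cast hy),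
    hσ.smul_apply h1 (smul_nonneg y.coe_nonneg h1) (by exact_mod_cast hy.trans_le hyx), hf.2, hf.2,
    smul_smul, smul_smul, smul_one_le_smul_one_iff] at h
  exact_mod_cast h

omit [CompleteSpace H] in
theorem sotTendsto_of_tendsto {A : ℕ → H →L[ℂ] H} {A₀ : H →L[ℂ] H}
    (h : Tendsto A atTop (𝓝 A₀)) : SOTTendsto A A₀ :=
  fun x => ((ContinuousLinearMap.apply ℂ H x).continuous.tendsto A₀).comp h

theorem representing_continuous [Nontrivial H] (hσ : IsConnection σ)
    (hf : IsRepresentingFunction σ f) (h0 : f 0 = 0) : Continuous f := by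
  have hmono := hσ.representing_monotone hf
  rw [continuous_iff_continuousAt]
  intro x₀
  rcases eq_zero_or_pos x₀ with rfl | hx₀
  · obtain ⟨v, hv⟩ := exists_ne (0 : H)
    have h1 : (0 : H →L[ℂ] H) ≤ 1 := zero_le_one
    have ht : Tendsto (fun n : ℕ => (1 / ((n : ℝ) + 1)) • (1 : H →L[ℂ] H)) atTop (𝓝 0) := by
      simpa using (tendsto_one_div_add_atTop_nhds_zero_nat (𝕜 := ℝ)).smul_const (1 : H →L[ℂ] H)
    have hp : ∀ n : ℕ, (0 : ℝ) ≤ 1 / ((n : ℝ) + 1) := fun n => by positivity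
    have h := (hσ.contFromAbove (fun _ => 1) (fun n : ℕ => (1 / ((n : ℝ) + 1)) • 1) 1 0
      (fun _ => (nonneg_iff_isPositive _).1 h1)
      (fun n => (nonneg_iff_isPositive _).1 (smul_nonneg (hp n) h1))
      ((nonneg_iff_isPositive _).1 h1) ((nonneg_iff_isPositive _).1 le_rfl) (fun _ _ _ => le_rfl)
      (fun m n hmn => smul_one_le_smul_one_iff.2 (Nat.one_div_le_one_div hmn))
      (sotTendsto_of_tendsto tendsto_const_nhds) (sotTendsto_of_tendsto ht)).2 v
    have hz : σ 1 (0 : H →L[ℂ] H) = 0 := by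
      have := hf.2 0
      simpa [h0] using this
    have hn : ∀ n : ℕ, σ 1 ((1 / ((n : ℝ) + 1)) • 1) =
        (f (1 / ((n : ℝ≥0) + 1)) : ℝ) • (1 : H →L[ℂ] H) := by
      intro n
      rw [← hf.2]
      push_cast
      rfl
    simp only [hn, hz] at h
    have h' := h.norm
    simp only [_root_.smul_apply, norm_smul, zero_apply, norm_zero,
      Real.norm_eq_abs, NNReal.abs_eq] at h'
    have h'' : Tendsto (fun n : ℕ => (f (1 / ((n : ℝ≥0) + 1)) : ℝ)) atTop (𝓝 0) := by
      simpa [norm_ne_zero_iff.2 hv] using h'.mul_const (‖v‖⁻¹)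
    rw [ContinuousAt, h0, tendsto_order]
    refine ⟨fun a ha => absurd ha not_lt_zero, fun ε hε => ?_⟩
    obtain ⟨n, hn⟩ := ((tendsto_order.1 h'').2 ε hε).exists
    filter_upwards [eventually_lt_nhds (show (0 : ℝ≥0) < 1 / ((n : ℝ≥0) + 1) by positivity)]
      with x hx
    exact (hmono hx.le).trans_lt (by exact_mod_cast hn)
  · have hlow : ∀ x, min (x / x₀) 1 * f x₀ ≤ f x := by
      intro x
      rcases le_total x x₀ with h | h
      · rcases eq_zero_or_pos x with rfl | hx
        · simp
        · calc min (x / x₀) 1 * f x₀ ≤ x / x₀ * f x₀ := by gcongr; exact min_le_left _ _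
            _ = x * f x₀ / x₀ := by rw [div_mul_eq_mul_div]
            _ ≤ x₀ * f x / x₀ := by gcongr ?_ / x₀; exact hσ.mul_representing_le hf hx h
            _ = f x := by rw [mul_div_cancel_left₀ _ hx₀.ne']
      · calc min (x / x₀) 1 * f x₀ ≤ 1 * f x₀ := by gcongr; exact min_le_right _ _
          _ ≤ f x := by rw [one_mul]; exact hmono h
    have hup : ∀ x, f x ≤ max (x / x₀) 1 * f x₀ := by
      intro x
      rcases le_total x x₀ with h | h
      · calc f x ≤ 1 * f x₀ := by rw [one_mul]; exact hmono h
          _ ≤ max (x / x₀) 1 * f x₀ := by gcongr; exact le_max_right _ _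
      · calc f x = x₀ * f x / x₀ := by rw [mul_div_cancel_left₀ _ hx₀.ne']
          _ ≤ x * f x₀ / x₀ := by gcongr ?_ / x₀; exact hσ.mul_representing_le hf hx₀ h
          _ = x / x₀ * f x₀ := by rw [div_mul_eq_mul_div]
          _ ≤ max (x / x₀) 1 * f x₀ := by gcongr; exact le_max_left _ _
    have c₁ : Continuous fun x : ℝ≥0 => min (x / x₀) 1 * f x₀ := by fun_prop
    have c₂ : Continuous fun x : ℝ≥0 => max (x / x₀) 1 * f x₀ := by fun_prop
    refine tendsto_of_tendsto_of_tendsto_of_le_of_le ?_ ?_ hlow hup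
    · simpa [div_self hx₀.ne'] using c₁.tendsto x₀
    · simpa [div_self hx₀.ne'] using c₂.tendsto x₀

end IsConnection

namespace IsConnection

variable {σ : (H →L[ℂ] H) → (H →L[ℂ] H) → (H →L[ℂ] H)}

/-- For an operator commuting with `X` the transformer inequality at `(1, X)` is an equality, even
when the operator is not invertible. -/
theorem conj_one_eq_of_commute (hσ : IsConnection σ) {X C : H →L[ℂ] H} (hX : 0 ≤ X) (hC : 0 ≤ C)
    (hXC : Commute X C) : C * σ 1 X * C = σ (C * C) (C * X * C) := by
  have h1 : (0 : H →L[ℂ] H) ≤ 1 := zero_le_one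
  set e : ℕ → ℝ := fun n => 1 / ((n : ℝ) + 1) with he
  have hpos : ∀ n, 0 < e n := fun n => by positivity
  have hanti : Antitone e := fun m n hmn => Nat.one_div_le_one_div hmn
  have htend : Tendsto e atTop (𝓝 0) := tendsto_one_div_add_atTop_nhds_zero_nat
  set Cs : ℕ → H →L[ℂ] H := fun n => C + e n • 1 with hCs
  have hCs0 : ∀ n, 0 ≤ Cs n := fun n => add_nonneg hC (smul_nonneg (hpos n).le h1)
  have hCst : Tendsto Cs atTop (𝓝 C) := by
    simpa using tendsto_const_nhds.add (htend.smul_const (1 : H →L[ℂ] H))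
  have expand : ∀ Y : H →L[ℂ] H, ∀ n,
      Cs n * Y * Cs n = C * Y * C + e n • (C * Y + Y * C) + (e n * e n) • Y := by
    intro Y n
    simp only [hCs, add_mul, mul_add, smul_mul_assoc, mul_smul_comm, one_mul, mul_one, smul_add,
      smul_smul]
    abel
  have anti : ∀ Y : H →L[ℂ] H, 0 ≤ Y → Commute Y C → Antitone fun n => Cs n * Y * Cs n := by
    intro Y hY hYC m n hmn
    simp only [expand]
    have hnn : 0 ≤ C * Y + Y * C :=
      add_nonneg (hYC.symm.mul_nonneg hC hY) (hYC.mul_nonneg hY hC)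
    refine add_le_add (add_le_add le_rfl ?_) ?_
    · exact smul_le_smul_of_nonneg_right (hanti hmn) hnn
    · exact smul_le_smul_of_nonneg_right
        (mul_le_mul (hanti hmn) (hanti hmn) (hpos n).le (hpos m).le) hY
  have tend : ∀ Y : H →L[ℂ] H, Tendsto (fun n => Cs n * Y * Cs n) atTop (𝓝 (C * Y * C)) :=
    fun Y => (hCst.mul_const Y).mul hCst
  have pos : ∀ Z Y : H →L[ℂ] H, 0 ≤ Z → 0 ≤ Y → 0 ≤ Z * Y * Z := fun Z Y hZ hY =>
    (IsSelfAdjoint.of_nonneg hZ).conjugate_nonneg hY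
  have key : ∀ n, Cs n * σ 1 X * Cs n = σ (Cs n * 1 * Cs n) (Cs n * X * Cs n) := by
    intro n
    obtain ⟨D, hD, hCD, hDC⟩ := exists_nonneg_inverse hC (hpos n)
    exact hσ.conj_eq h1 hX (hCs0 n) hD hCD hDC
  have hlim := (hσ.contFromAbove _ _ (C * 1 * C) (C * X * C)
    (fun n => (nonneg_iff_isPositive _).1 (pos _ _ (hCs0 n) h1))
    (fun n => (nonneg_iff_isPositive _).1 (pos _ _ (hCs0 n) hX))
    ((nonneg_iff_isPositive _).1 (pos _ _ hC h1)) ((nonneg_iff_isPositive _).1 (pos _ _ hC hX))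
    (anti 1 h1 (Commute.one_left C)) (anti X hX hXC)
    (sotTendsto_of_tendsto (tend 1)) (sotTendsto_of_tendsto (tend X))).2
  simp only [← key] at hlim
  ext v
  have := tendsto_nhds_unique (sotTendsto_of_tendsto (tend (σ 1 X)) v) (hlim v)
  rwa [mul_one] at this

theorem conj_one_eq (hσ : IsConnection σ) {X P : H →L[ℂ] H} (hX : 0 ≤ X)
    (hP : IsStarProjection P) (hXP : Commute X P) : P * σ 1 X * P = σ P (P * X * P) := by
  rw [hσ.conj_one_eq_of_commute hX hP.nonneg hXP, hP.isIdempotentElem.eq]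

theorem commute_one (hσ : IsConnection σ) {X P : H →L[ℂ] H} (hX : 0 ≤ X)
    (hP : IsStarProjection P) (hXP : Commute X P) : Commute P (σ 1 X) := by
  have hPP : P * P = P := hP.isIdempotentElem
  have hPs := hP.isSelfAdjoint
  set T := σ 1 X with hT
  have hTs : IsSelfAdjoint T := IsSelfAdjoint.of_nonneg (hσ.nonneg zero_le_one hX)
  have hXle : P * X * P ≤ X := by
    have h := hP.one_sub.isSelfAdjoint.conjugate_nonneg hX
    have e : (1 - P) * X * (1 - P) = X - P * X * P := by
      simp only [sub_mul, mul_sub, one_mul, mul_one, hXP.eq, mul_assoc]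
      rw [← mul_assoc P P X, hPP]
      abel
    rw [e] at h
    exact sub_nonneg.1 h
  have hD : 0 ≤ T - P * T * P := by
    rw [sub_nonneg, hσ.conj_one_eq hX hP hXP]
    exact hσ.apply_le_apply hP.nonneg (hPs.conjugate_nonneg hX) (sub_nonneg.1 hP.one_sub.nonneg)
      hXle
  set D := T - P * T * P with hDdef
  have hPDP : P * D * P = 0 := by
    rw [hDdef, mul_sub, sub_mul, sub_eq_zero]
    simp only [mul_assoc, hPP]
    rw [← mul_assoc P P, hPP]
  have hDP : D * P = 0 := by
    have hs := CFC.sqrt_mul_sqrt_self D hD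
    have hss : IsSelfAdjoint (CFC.sqrt D) := IsSelfAdjoint.of_nonneg (CFC.sqrt_nonneg D)
    have h : star (CFC.sqrt D * P) * (CFC.sqrt D * P) = 0 := by
      rw [star_mul, hss.star_eq, hPs.star_eq, ← hPDP, ← hs]
      simp only [mul_assoc]
      rw [hs]
    rw [CStarRing.star_mul_self_eq_zero_iff] at h
    rw [← hs, mul_assoc, h, mul_zero]
  have hTP : T * P = P * T * P := by
    rw [hDdef, sub_mul, sub_eq_zero] at hDP
    rw [hDP, mul_assoc (P * T), hPP]
  have h := congrArg star hTP
  simp only [star_mul, hPs.star_eq, hTs.star_eq] at h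
  rw [Commute, SemiconjBy, h, ← mul_assoc, ← hTP]

variable {f : ℝ≥0 → ℝ≥0}

theorem conj_one_smul (hσ : IsConnection σ) (hf : IsRepresentingFunction σ f) {P : H →L[ℂ] H}
    (hP : IsStarProjection P) (x : ℝ≥0) : σ P ((x : ℝ) • P) = (f x : ℝ) • P := by
  have hPP : P * P = P := hP.isIdempotentElem
  have h := hσ.conj_one_eq (X := (x : ℝ) • 1) (smul_nonneg x.coe_nonneg zero_le_one) hP
    ((Commute.one_left P).smul_left _)
  simp only [hf.2, mul_smul_comm, smul_mul_assoc, mul_one, hPP] at h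
  exact h.symm

theorem smul_le_conj_le_smul (hσ : IsConnection σ) (hf : IsRepresentingFunction σ f)
    {X P : H →L[ℂ] H} (hX : 0 ≤ X) (hP : IsStarProjection P) (hXP : Commute X P) {a b : ℝ≥0}
    (ha : (a : ℝ) • P ≤ P * X * P) (hb : P * X * P ≤ (b : ℝ) • P) :
    (f a : ℝ) • P ≤ P * σ 1 X * P ∧ P * σ 1 X * P ≤ (f b : ℝ) • P := by
  rw [hσ.conj_one_eq hX hP hXP, ← hσ.conj_one_smul hf hP, ← hσ.conj_one_smul hf hP]
  exact ⟨hσ.apply_le_apply hP.nonneg (smul_nonneg a.coe_nonneg hP.nonneg) le_rfl ha,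
    hσ.apply_le_apply hP.nonneg (hP.isSelfAdjoint.conjugate_nonneg hX) le_rfl hb⟩

/-- The representing function determines the connection at `(1, X)`. -/
theorem one_eq_cfc [Nontrivial H] (hσ : IsConnection σ) (hf : IsRepresentingFunction σ f)
    (h0 : f 0 = 0) {X : H →L[ℂ] H} (hX : 0 ≤ X) : σ 1 X = cfc f X := by
  have hfc := hσ.representing_continuous hf h0
  have hfm := hσ.representing_monotone hf
  set g : ℝ → ℝ := fun r => f r.toNNReal with hg
  have hgc : Continuous g := by fun_prop
  have hgm : Monotone g := fun x y hxy => by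
    simp only [hg]
    exact_mod_cast hfm (Real.toNNReal_le_toNNReal hxy)
  have hXs := IsSelfAdjoint.of_nonneg hX
  rw [cfc_nnreal_eq_real f X hX]
  change σ 1 X = cfc g X
  have hlocal : ∀ Q : H →L[ℂ] H, IsStarProjection Q → Commute Q X → ∀ a b : ℝ, 0 ≤ a → a ≤ b →
      a • Q ≤ Q * X * Q → Q * X * Q ≤ b • Q →
      Q * (σ 1 X - cfc g X) * Q ≤ (g b - g a) • Q ∧
        Q * (cfc g X - σ 1 X) * Q ≤ (g b - g a) • Q := by
    intro Q hQ hQX a b ha0 hab ha hb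
    obtain ⟨h₁, h₂⟩ := smul_le_conj_cfc_le_smul hgc hgm hXs hQ hQX.symm hab ha hb
    obtain ⟨h₃, h₄⟩ := hσ.smul_le_conj_le_smul hf hX hQ hQX.symm (a := a.toNNReal)
      (b := b.toNNReal) (by rwa [Real.coe_toNNReal a ha0])
      (by rwa [Real.coe_toNNReal b (ha0.trans hab)])
    simp only [mul_sub, sub_mul, sub_smul]
    exact ⟨sub_le_sub h₄ h₁, sub_le_sub h₂ h₃⟩
  have hone : IsStarProjection (1 : H →L[ℂ] H) := IsStarProjection.one _
  have hXle : X ≤ ‖X‖ • 1 := by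
    rw [← Algebra.algebraMap_eq_smul_one]
    exact hXs.le_algebraMap_norm_self
  have hcT : ∀ P : H →L[ℂ] H, IsStarProjection P → Commute P X → Commute P (σ 1 X) :=
    fun P hP hPX => hσ.commute_one hX hP hPX.symm
  have hcF : ∀ P : H →L[ℂ] H, IsStarProjection P → Commute P X → Commute P (cfc g X) :=
    fun P hP hPX => (Commute.cfc hPX.symm (by rw [hXs.star_eq]; exact hPX.symm) g).symm
  have main : ∀ ε : ℝ, 0 < ε → σ 1 X - cfc g X ≤ ε • 1 ∧ cfc g X - σ 1 X ≤ ε • 1 := by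
    intro ε hε
    have huc := (isCompact_Icc (a := (0 : ℝ)) (b := ‖X‖)).uniformContinuousOn_of_continuous
      hgc.continuousOn
    obtain ⟨δ, hδ, hδε⟩ := Metric.uniformContinuousOn_iff_le.1 huc ε hε
    obtain ⟨n, hn⟩ := exists_nat_ge (‖X‖ / δ)
    have hlen : ‖X‖ - 0 ≤ ((n : ℝ) + 1) * δ := by
      rw [div_le_iff₀ hδ] at hn
      linarith
    have hosc : ∀ a b : ℝ, 0 ≤ a → a ≤ b → b ≤ ‖X‖ → b - a ≤ δ → g b - g a ≤ ε := by
      intro a b ha hab hb hd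
      refine (le_abs_self _).trans (hδε b ⟨ha.trans hab, hb⟩ a ⟨ha, hab.trans hb⟩ ?_)
      rwa [Real.dist_eq, abs_of_nonneg (sub_nonneg.2 hab)]
    have b₀ : (0 : ℝ) • (1 : H →L[ℂ] H) ≤ 1 * X * 1 := by simpa using hX
    have b₁ : 1 * X * 1 ≤ ‖X‖ • (1 : H →L[ℂ] H) := by simpa using hXle
    constructor
    · have := conj_le_smul_of_small (W := σ 1 X - cfc g X) (ε := ε) hXs hδ.le
        (fun P hP hPX => (hcT P hP hPX).sub_right (hcF P hP hPX)) (m := 0) (M := ‖X‖)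
        (fun Q hQ hQX a b ha hab hb hd h₁ h₂ => ((hlocal Q hQ hQX a b ha hab h₁ h₂).1).trans
          (smul_le_smul_of_nonneg_right (hosc a b ha hab hb hd) hQ.nonneg)) n 1 hone
        (Commute.one_left X) 0 ‖X‖ le_rfl (norm_nonneg X) le_rfl hlen b₀ b₁
      simpa using this
    · have := conj_le_smul_of_small (W := cfc g X - σ 1 X) (ε := ε) hXs hδ.le
        (fun P hP hPX => (hcF P hP hPX).sub_right (hcT P hP hPX)) (m := 0) (M := ‖X‖)
        (fun Q hQ hQX a b ha hab hb hd h₁ h₂ => ((hlocal Q hQ hQX a b ha hab h₁ h₂).2).trans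
          (smul_le_smul_of_nonneg_right (hosc a b ha hab hb hd) hQ.nonneg)) n 1 hone
        (Commute.one_left X) 0 ‖X‖ le_rfl (norm_nonneg X) le_rfl hlen b₀ b₁
      simpa using this
  have hlim : Tendsto (fun ε : ℝ => ε • (1 : H →L[ℂ] H)) (𝓝[>] 0) (𝓝 0) := by
    have : Tendsto (fun ε : ℝ => ε • (1 : H →L[ℂ] H)) (𝓝 0) (𝓝 ((0 : ℝ) • 1)) :=
      tendsto_id.smul_const _
    rw [zero_smul] at this
    exact this.mono_left nhdsWithin_le_nhds
  refine le_antisymm ?_ ?_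
  · refine sub_nonpos.1 (ge_of_tendsto hlim ?_)
    filter_upwards [self_mem_nhdsWithin] with ε hε using (main ε hε).1
  · refine sub_nonpos.1 (ge_of_tendsto hlim ?_)
    filter_upwards [self_mem_nhdsWithin] with ε hε using (main ε hε).2

end IsConnection

theorem IsStarProjection.cfc_smul_add_smul {K : Type} [NormedAddCommGroup K]
    [InnerProductSpace ℂ K] [CompleteSpace K] {g : ℝ → ℝ} (hg : Continuous g) {P : K →L[ℂ] K}
    (hP : IsStarProjection P) (x y : ℝ) :
    cfc g (x • P + y • (1 - P)) = g x • P + g y • (1 - P) := by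
  have hPs := hP.isSelfAdjoint
  have haff : ∀ a b : ℝ, cfc (fun t : ℝ => a * t + b * (1 - t)) P = a • P + b • (1 - P) := by
    intro a b
    rw [cfc_add P _ _, cfc_const_mul _ _ P, cfc_const_mul _ _ P, cfc_sub _ _ P, cfc_id' ℝ P,
      cfc_const_one ℝ P]
  rw [← haff, ← haff, ← cfc_comp' g _ P hg.continuousOn]
  refine cfc_congr fun t ht => ?_
  rcases hP.isIdempotentElem.spectrum_subset ℝ ht with rfl | h
  · simp
  · rw [Set.mem_singleton_iff] at h
    simp [h]

/-- An operator monotone function is concave. -/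
theorem OperatorMonotone.concave_of_projection {f : ℝ≥0 → ℝ≥0} (hf : OperatorMonotone f)
    (hfc : Continuous f) {K : Type} [NormedAddCommGroup K] [InnerProductSpace ℂ K]
    [CompleteSpace K] {P : K →L[ℂ] K} (hP : IsStarProjection P) {e : K} (he : ‖e‖ = 1) {s : ℝ}
    (hs : inner ℂ e (P e) = (s : ℂ)) (x y : ℝ≥0) :
    s * (f x : ℝ) + (1 - s) * (f y : ℝ) ≤ f (s * (x : ℝ) + (1 - s) * (y : ℝ)).toNNReal := by
  set g : ℝ → ℝ := fun r => f r.toNNReal with hg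
  have hgc : Continuous g := by fun_prop
  set m : ℝ := s * (x : ℝ) + (1 - s) * (y : ℝ) with hm
  have hee : inner ℂ e e = (1 : ℂ) := by simp [inner_self_eq_norm_sq_to_K, he]
  set E : K →L[ℂ] K := InnerProductSpace.rankOne ℂ e e with hEdef
  have hE : IsStarProjection E :=
    ⟨InnerProductSpace.isIdempotentElem_rankOne_self he,
      (InnerProductSpace.isPositive_rankOne_self e).isSelfAdjoint⟩
  have hEe : E e = e := by simp [hEdef, InnerProductSpace.rankOne_apply, he]
  set A : K →L[ℂ] K := (x : ℝ) • P + (y : ℝ) • (1 - P) with hAdef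
  have hA : 0 ≤ A := add_nonneg (smul_nonneg x.coe_nonneg hP.nonneg)
    (smul_nonneg y.coe_nonneg hP.one_sub.nonneg)
  have hinner : ∀ a b : ℝ, inner ℂ e ((a • P + b • (1 - P)) e) = ((s * a + (1 - s) * b : ℝ) : ℂ) := by
    intro a b
    simp only [_root_.add_apply, _root_.smul_apply, _root_.sub_apply, one_apply_eq_self, inner_add_right,
      inner_sub_right, inner_smul_right_eq_smul, hs, hee, Complex.real_smul]
    push_cast
    ring
  have hEAE : E * A * E = m • E := by
    ext v
    simp only [hEdef, mul_apply_eq_comp, InnerProductSpace.rankOne_apply, _root_.smul_apply, map_smul]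
    rw [hAdef, hinner, ← hm]
    rw [Complex.coe_smul, smul_comm]
  have hm0 : 0 ≤ m := by
    have := (nonneg_iff_isPositive A).1 hA
    have h := this.re_inner_nonneg_right e
    rw [hAdef, hinner] at h
    simpa [hm] using h
  have hbound : ∀ η : ℝ, 0 < η → s * (f x : ℝ) + (1 - s) * (f y : ℝ) ≤ g ((1 + η) * m) := by
    intro η hη
    have hr : 0 < √η := Real.sqrt_pos.2 hη
    have hrr : √η * √η = η := Real.mul_self_sqrt hη.le
    set L : ℝ := (1 + η⁻¹) * ‖A‖ with hL
    have hL0 : 0 ≤ L := by positivity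
    set B : K →L[ℂ] K := ((1 + η) * m) • E + L • (1 - E) with hB
    have hAB : A ≤ B := by
      have h₁ : 0 ≤ (√η • E - (√η)⁻¹ • (1 - E)) * A * (√η • E - (√η)⁻¹ • (1 - E)) := by
        have hs' : IsSelfAdjoint (√η • E - (√η)⁻¹ • (1 - E)) :=
          ((IsSelfAdjoint.all _).smul hE.isSelfAdjoint).sub
            ((IsSelfAdjoint.all _).smul hE.one_sub.isSelfAdjoint)
        exact hs'.conjugate_nonneg hA
      have h₂ : (√η • E - (√η)⁻¹ • (1 - E)) * A * (√η • E - (√η)⁻¹ • (1 - E)) =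
          (1 + η) • (E * A * E) + (1 + η⁻¹) • ((1 - E) * A * (1 - E)) - A := by
        have hexp : ∀ (p q : ℝ) (F : K →L[ℂ] K), (p • E - q • F) * A * (p • E - q • F) =
            (p * p) • (E * A * E) - (p * q) • (E * A * F) - (q * p) • (F * A * E) +
              (q * q) • (F * A * F) := by
          intro p q F
          simp only [sub_mul, mul_sub, smul_mul_assoc, mul_smul_comm]
          module
        have hsplit : A = E * A * E + E * A * (1 - E) + (1 - E) * A * E +
            (1 - E) * A * (1 - E) := by noncomm_ring
        rw [hexp, hrr, mul_inv_cancel₀ hr.ne', inv_mul_cancel₀ hr.ne', ← mul_inv, hrr,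
          eq_sub_iff_add_eq]
        nth_rw 5 [hsplit]
        module
      have h₃ : (1 - E) * A * (1 - E) ≤ ‖A‖ • (1 - E) := by
        have hle : A ≤ ‖A‖ • 1 := by
          rw [← Algebra.algebraMap_eq_smul_one]
          exact (IsSelfAdjoint.of_nonneg hA).le_algebraMap_norm_self
        have := hE.one_sub.isSelfAdjoint.conjugate_le_conjugate hle
        simpa only [mul_smul_comm, smul_mul_assoc, mul_one, hE.one_sub.isIdempotentElem.eq]
          using this
      rw [h₂, sub_nonneg, hEAE] at h₁
      refine h₁.trans ?_
      rw [hB, hL, mul_smul, mul_smul]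
      exact add_le_add le_rfl (smul_le_smul_of_nonneg_left h₃ (by positivity))
    have hB0 : 0 ≤ B := hA.trans hAB
    have h := hf K A B ((nonneg_iff_isPositive _).1 hA) ((nonneg_iff_isPositive _).1 hB0) hAB
    rw [cfc_nnreal_eq_real f A hA, cfc_nnreal_eq_real f B hB0] at h
    change cfc g A ≤ cfc g B at h
    rw [hAdef, hB, hP.cfc_smul_add_smul hgc, hE.cfc_smul_add_smul hgc] at h
    have h' := ((nonneg_iff_isPositive _).1 (sub_nonneg.2 h)).re_inner_nonneg_right e
    rw [_root_.sub_apply, inner_sub_right, hinner] at h'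
    have hBe : (g ((1 + η) * m) • E + g L • (1 - E)) e = g ((1 + η) * m) • e := by
      simp [hEe]
    rw [hBe, inner_smul_right_eq_smul, hee] at h'
    simpa [hg] using h'
  have hlim : Tendsto (fun η : ℝ => g ((1 + η) * m)) (𝓝[>] 0) (𝓝 (g m)) := by
    have hc : Continuous fun η : ℝ => g ((1 + η) * m) := by fun_prop
    have := hc.tendsto 0
    simp only [add_zero, one_mul] at this
    exact this.mono_left nhdsWithin_le_nhds
  refine ge_of_tendsto hlim ?_
  filter_upwards [self_mem_nhdsWithin] with η hη using hbound η hη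

theorem OperatorMonotone.concave {f : ℝ≥0 → ℝ≥0} (hf : OperatorMonotone f) (hfc : Continuous f)
    {s : ℝ} (hs₀ : 0 ≤ s) (hs₁ : s ≤ 1) (x y : ℝ≥0) :
    s * (f x : ℝ) + (1 - s) * (f y : ℝ) ≤ f (s * (x : ℝ) + (1 - s) * (y : ℝ)).toNNReal := by
  set u : EuclideanSpace ℂ (Fin 2) := !₂[(√s : ℂ), (√(1 - s) : ℂ)] with hu
  have hun : ‖u‖ = 1 := by
    rw [EuclideanSpace.norm_eq, Fin.sum_univ_two]
    simp [hu, Real.sq_sqrt, hs₀, hs₁]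
  refine hf.concave_of_projection hfc (P := InnerProductSpace.rankOne ℂ u u)
    ⟨InnerProductSpace.isIdempotentElem_rankOne_self hun,
      (InnerProductSpace.isPositive_rankOne_self u).isSelfAdjoint⟩
    (e := EuclideanSpace.single 0 1) (by simp) ?_ x y
  rw [InnerProductSpace.rankOne_apply, inner_smul_right]
  have h : (√s : ℂ) * √s = s := by exact_mod_cast Real.mul_self_sqrt hs₀
  simp [hu, h, EuclideanSpace.inner_single_left, EuclideanSpace.inner_single_right]

theorem OperatorMonotone.strictMono {f : ℝ≥0 → ℝ≥0} (hf : OperatorMonotone f)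
    (hfc : Continuous f) (hfm : Monotone f) (hub : ¬ ∃ M : ℝ≥0, ∀ x, f x ≤ M) : StrictMono f := by
  intro x y hxy
  refine lt_of_le_of_ne (hfm hxy.le) fun heq => hub ⟨f y, fun z => ?_⟩
  rcases le_total z y with hzy | hyz
  · exact hfm hzy
  have hxy' : (x : ℝ) < y := by exact_mod_cast hxy
  have hyz' : (y : ℝ) ≤ z := by exact_mod_cast hyz
  have hd : 0 < (z : ℝ) - x := by linarith
  set s : ℝ := (z - y) / (z - x) with hs
  have hs₀ : 0 ≤ s := div_nonneg (by linarith) hd.le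
  have hs₁ : s < 1 := by rw [hs, div_lt_one hd]; linarith
  have h := hf.concave hfc hs₀ hs₁.le x z
  have hm : s * (x : ℝ) + (1 - s) * z = y := by rw [hs]; field_simp; ring
  rw [hm, Real.toNNReal_coe, heq] at h
  have : (1 - s) * (f z : ℝ) ≤ (1 - s) * f y := by linarith
  exact_mod_cast le_of_mul_le_mul_left this (by linarith)

theorem NNReal.surjective_of_continuous_of_unbounded {f : ℝ≥0 → ℝ≥0}
    (hfc : Continuous f) (h0 : f 0 = 0) (hub : ¬ ∃ M : ℝ≥0, ∀ x, f x ≤ M) :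
    Function.Surjective f := by
  intro y
  push Not at hub
  obtain ⟨x, hx⟩ := hub y
  obtain ⟨z, -, hz⟩ := intermediate_value_Icc (zero_le : 0 ≤ x) hfc.continuousOn
    (show y ∈ Set.Icc (f 0) (f x) from ⟨by simp [h0], hx.le⟩)
  exact ⟨z, hz⟩

theorem StrictMono.continuous_invFun {f : ℝ≥0 → ℝ≥0} (hfm : StrictMono f)
    (hs : Function.Surjective f) : Continuous (Function.invFun f) := by
  have h : Function.invFun f = (hfm.orderIsoOfSurjective f hs).symm := by
    funext y
    refine hfm.injective ?_
    rw [Function.rightInverse_invFun hs]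
    exact ((hfm.orderIsoOfSurjective f hs).apply_symm_apply y).symm
  rw [h]
  exact (hfm.orderIsoOfSurjective f hs).symm.continuous

section Roots

variable {A : H →L[ℂ] H}

omit [CompleteSpace H] in
theorem isStrictlyPositive_of_isUnit (hA : 0 ≤ A) (hu : IsUnit A) : IsStrictlyPositive A :=
  IsStrictlyPositive.iff_of_unital.2 ⟨hA, hu⟩

theorem sqrt_mul_rpow_neg_half (hA : 0 ≤ A) (hu : IsUnit A) :
    CFC.sqrt A * CFC.rpow A (-(1 / 2) : ℝ) = 1 := by
  rw [CFC.sqrt_eq_rpow]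
  exact CFC.rpow_mul_rpow_neg (1 / 2) (isStrictlyPositive_of_isUnit hA hu)

theorem rpow_neg_half_mul_sqrt (hA : 0 ≤ A) (hu : IsUnit A) :
    CFC.rpow A (-(1 / 2) : ℝ) * CFC.sqrt A = 1 := by
  rw [CFC.sqrt_eq_rpow]
  exact CFC.rpow_neg_mul_rpow (1 / 2) (isStrictlyPositive_of_isUnit hA hu)

theorem rpow_neg_half_nonneg : 0 ≤ CFC.rpow A (-(1 / 2) : ℝ) := CFC.rpow_nonneg

end Roots

omit [CompleteSpace H] in
theorem mul_mul_mul_cancel {S R : H →L[ℂ] H} (hSR : S * R = 1) (hRS : R * S = 1)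
    (Y : H →L[ℂ] H) : S * (R * Y * R) * S = Y := by
  rw [← mul_assoc, ← mul_assoc, hSR, one_mul, mul_assoc, hRS, mul_one]

theorem IsConnection.apply_eq [Nontrivial H] {σ : (H →L[ℂ] H) → (H →L[ℂ] H) → (H →L[ℂ] H)}
    (hσ : IsConnection σ) {f : ℝ≥0 → ℝ≥0} (hf : IsRepresentingFunction σ f) (h0 : f 0 = 0)
    {A X : H →L[ℂ] H} (hA : 0 ≤ A) (hu : IsUnit A) (hX : 0 ≤ X) :
    σ A X = CFC.sqrt A *
      cfc f (CFC.rpow A (-(1 / 2) : ℝ) * X * CFC.rpow A (-(1 / 2) : ℝ)) * CFC.sqrt A := by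
  have hSR := sqrt_mul_rpow_neg_half hA hu
  have hRS := rpow_neg_half_mul_sqrt hA hu
  have hRXR : 0 ≤ CFC.rpow A (-(1 / 2) : ℝ) * X * CFC.rpow A (-(1 / 2) : ℝ) :=
    (IsSelfAdjoint.of_nonneg rpow_neg_half_nonneg).conjugate_nonneg hX
  rw [← hσ.one_eq_cfc hf h0 hRXR, hσ.conj_eq zero_le_one hRXR (CFC.sqrt_nonneg A)
    rpow_neg_half_nonneg hSR hRS, mul_mul_mul_cancel hSR hRS, mul_one, CFC.sqrt_mul_sqrt_self A hA]

theorem solMap_nonneg (f : ℝ≥0 → ℝ≥0) (A B : H →L[ℂ] H) : 0 ≤ solMap f A B :=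
  (IsSelfAdjoint.of_nonneg (CFC.sqrt_nonneg A)).conjugate_nonneg (cfc_predicate _ _)

theorem solMap_solves [Nontrivial H] {σ : (H →L[ℂ] H) → (H →L[ℂ] H) → (H →L[ℂ] H)}
    (hσ : IsConnection σ) {f : ℝ≥0 → ℝ≥0} (hf : IsRepresentingFunction σ f) (h0 : f 0 = 0)
    (hfm : StrictMono f) (hfs : Function.Surjective f) {A B : H →L[ℂ] H} (hA : 0 ≤ A)
    (hu : IsUnit A) (hB : 0 ≤ B) :
    σ A (solMap f A B) = B ∧ ∀ X : H →L[ℂ] H, 0 ≤ X → σ A X = B → X = solMap f A B := by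
  have hSR := sqrt_mul_rpow_neg_half hA hu
  have hRS := rpow_neg_half_mul_sqrt hA hu
  have hR := IsSelfAdjoint.of_nonneg (rpow_neg_half_nonneg (A := A))
  have hfc := hσ.representing_continuous hf h0
  have hgc := hfm.continuous_invFun hfs
  constructor
  · have hY := hR.conjugate_nonneg hB
    rw [hσ.apply_eq hf h0 hA hu (solMap_nonneg f A B), solMap, mul_mul_mul_cancel hRS hSR,
      ← cfc_comp' f (Function.invFun f) _ hfc.continuousOn hgc.continuousOn hY]
    simp only [Function.rightInverse_invFun hfs _]
    rw [cfc_id' ℝ≥0 _ hY, mul_mul_mul_cancel hSR hRS]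
  · intro X hX hXB
    have hY := hR.conjugate_nonneg hX
    rw [solMap, ← hXB, hσ.apply_eq hf h0 hA hu hX, mul_mul_mul_cancel hRS hSR,
      ← cfc_comp' (Function.invFun f) f _ hgc.continuousOn hfc.continuousOn hY]
    simp only [Function.leftInverse_invFun hfm.injective _]
    rw [cfc_id' ℝ≥0 _ hY, mul_mul_mul_cancel hSR hRS]

namespace SOTTendsto

variable {A B : ℕ → H →L[ℂ] H} {A₀ B₀ : H →L[ℂ] H}

omit [CompleteSpace H] in
theorem add (hA : SOTTendsto A A₀) (hB : SOTTendsto B B₀) :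
    SOTTendsto (fun n => A n + B n) (A₀ + B₀) :=
  fun x => (hA x).add (hB x)

omit [CompleteSpace H] in
theorem const (A₀ : H →L[ℂ] H) : SOTTendsto (fun _ => A₀) A₀ := fun _ => tendsto_const_nhds

theorem exists_norm_le (hA : SOTTendsto A A₀) : ∃ M : ℝ, ∀ n, ‖A n‖ ≤ M := by
  refine banach_steinhaus fun x => ?_
  obtain ⟨C, hC⟩ := (Metric.isBounded_range_of_tendsto _ (hA x)).exists_norm_le
  exact ⟨C, fun n => hC _ ⟨n, rfl⟩⟩

theorem mul (hA : SOTTendsto A A₀) (hB : SOTTendsto B B₀) :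
    SOTTendsto (fun n => A n * B n) (A₀ * B₀) := by
  obtain ⟨M, hM⟩ := hA.exists_norm_le
  intro x
  have h₁ : Tendsto (fun n => A n (B n x - B₀ x)) atTop (𝓝 0) := by
    have h : Tendsto (fun n => M * ‖B n x - B₀ x‖) atTop (𝓝 0) := by
      simpa using ((tendsto_iff_norm_sub_tendsto_zero.1 (hB x)).const_mul M)
    exact squeeze_zero_norm (fun n => (A n).le_of_opNorm_le (hM n) _) h
  have h₂ := h₁.add (hA (B₀ x))
  simpa using h₂

theorem pow (hA : SOTTendsto A A₀) (k : ℕ) :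
    SOTTendsto (fun n => A n ^ k) (A₀ ^ k) := by
  induction k with
  | zero => simpa using const (1 : H →L[ℂ] H)
  | succ k ih => simpa only [pow_succ'] using mul hA ih

theorem aeval (hA : SOTTendsto A A₀) (p : Polynomial ℝ) :
    SOTTendsto (fun n => Polynomial.aeval (A n) p) (Polynomial.aeval A₀ p) := by
  induction p using Polynomial.induction_on' with
  | add p q hp hq => simpa only [map_add] using hp.add hq
  | monomial k c =>
    simp only [Polynomial.aeval_monomial, ← Algebra.smul_def]
    exact fun x => (pow hA k x).const_smul c

/-- A continuous function is sequentially continuous in the strong operator topology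
on selfadjoint operators. -/
theorem cfc [Nontrivial H] {g : ℝ → ℝ} (hg : Continuous g)
    (hAs : ∀ n, IsSelfAdjoint (A n)) (hA₀s : IsSelfAdjoint A₀) (hA : SOTTendsto A A₀) :
    SOTTendsto (fun n => _root_.cfc g (A n)) (_root_.cfc g A₀) := by
  obtain ⟨M, hM⟩ := hA.exists_norm_le
  intro x
  rw [Metric.tendsto_atTop]
  intro ε hε
  have hd : 0 < ε / (4 * (‖x‖ + 1)) := by positivity
  obtain ⟨p, hp⟩ := exists_polynomial_norm_cfc_sub_le (H := H) hg (max M ‖A₀‖) hd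
  have hsmall : ε / (4 * (‖x‖ + 1)) * ‖x‖ ≤ ε / 4 := by
    rw [div_mul_eq_mul_div, div_le_div_iff₀ (by positivity) (by positivity)]
    nlinarith [norm_nonneg x]
  obtain ⟨N, hN⟩ := Metric.tendsto_atTop.1 (aeval hA p x) (ε / 4) (by positivity)
  refine ⟨N, fun n hn => ?_⟩
  have h₁ := (ContinuousLinearMap.le_of_opNorm_le _
    (hp (A n) (hAs n) ((hM n).trans (le_max_left _ _))) x).trans hsmall
  have h₂ := (ContinuousLinearMap.le_of_opNorm_le _ (hp A₀ hA₀s (le_max_right _ _)) x).trans hsmall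
  have h₃ := hN n hn
  rw [_root_.sub_apply, ← dist_eq_norm] at h₁ h₂
  rw [dist_comm] at h₂
  linarith [dist_triangle4 (_root_.cfc g (A n) x) (Polynomial.aeval (A n) p x)
    (Polynomial.aeval A₀ p x) (_root_.cfc g A₀ x)]

open scoped ComplexOrder in
omit [CompleteSpace H] in
theorem nonneg (hA : SOTTendsto A A₀) (h : ∀ n, 0 ≤ A n) : 0 ≤ A₀ := by
  simp only [nonneg_iff_isPositive] at h ⊢
  refine (ContinuousLinearMap.isPositive_iff_complex _).2 fun x => ?_
  have hlim : Tendsto (fun n => inner ℂ (A n x) x) atTop (𝓝 (inner ℂ (A₀ x) x)) :=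
    (hA x).inner tendsto_const_nhds
  have hx : 0 ≤ inner ℂ (A₀ x) x := ge_of_tendsto' hlim fun n => (h n).inner_nonneg_left x
  obtain ⟨h₁, h₂⟩ := Complex.nonneg_iff.1 hx
  exact ⟨Complex.ext rfl h₂, h₁⟩

end SOTTendsto

theorem cfc_nnreal_eq_cfc_real (f : ℝ≥0 → ℝ≥0) {X : H →L[ℂ] H} (hX : 0 ≤ X) :
    cfc f X = cfc (fun r : ℝ => (f r.toNNReal : ℝ)) X :=
  cfc_nnreal_eq_real f X hX

theorem rpow_eq_cfc_of_smul_one_le {ε : ℝ} {X : H →L[ℂ] H} (hX : 0 ≤ X) (hεX : ε • 1 ≤ X) (p : ℝ) :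
    CFC.rpow X p = cfc (fun r : ℝ => max r ε ^ p) X := by
  have hXs := IsSelfAdjoint.of_nonneg hX
  change cfc (fun x : ℝ≥0 => x ^ p) X = _
  rw [cfc_nnreal_eq_cfc_real _ hX]
  refine cfc_congr fun r hr => ?_
  rw [← Algebra.algebraMap_eq_smul_one] at hεX
  have hεr := (algebraMap_le_iff_le_spectrum hXs).1 hεX r hr
  have hr0 : 0 ≤ r := spectrum_nonneg_of_nonneg hX hr
  simp [NNReal.coe_rpow, Real.coe_toNNReal r hr0, max_eq_left hεr]

namespace SOTTendsto

variable [Nontrivial H] {A B : ℕ → H →L[ℂ] H} {A₀ B₀ : H →L[ℂ] H}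

theorem cfc_nnreal {f : ℝ≥0 → ℝ≥0} (hf : Continuous f) (hA0 : ∀ n, 0 ≤ A n)
    (hA : SOTTendsto A A₀) : SOTTendsto (fun n => _root_.cfc f (A n)) (_root_.cfc f A₀) := by
  have hA₀ := hA.nonneg hA0
  simp only [cfc_nnreal_eq_cfc_real f (hA0 _), cfc_nnreal_eq_cfc_real f hA₀]
  exact hA.cfc (by fun_prop) (fun n => .of_nonneg (hA0 n)) (.of_nonneg hA₀)

theorem sqrt (hA0 : ∀ n, 0 ≤ A n) (hA : SOTTendsto A A₀) :
    SOTTendsto (fun n => CFC.sqrt (A n)) (CFC.sqrt A₀) := by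
  have hA₀ := hA.nonneg hA0
  simp only [CFC.sqrt_eq_cfc]
  exact hA.cfc_nnreal NNReal.continuous_sqrt hA0

theorem rpow {ε : ℝ} (hε : 0 < ε) (hεA : ∀ n, ε • 1 ≤ A n) (hA : SOTTendsto A A₀) (p : ℝ) :
    SOTTendsto (fun n => CFC.rpow (A n) p) (CFC.rpow A₀ p) := by
  have hε1 : (0 : H →L[ℂ] H) ≤ ε • 1 := smul_nonneg hε.le zero_le_one
  have hA0 : ∀ n, 0 ≤ A n := fun n => hε1.trans (hεA n)
  have hεA₀ : ε • 1 ≤ A₀ := by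
    refine sub_nonneg.1 ?_
    exact SOTTendsto.nonneg (A := fun n => A n - ε • 1) (fun x => (hA x).sub tendsto_const_nhds)
      fun n => sub_nonneg.2 (hεA n)
  have hA₀ := hA.nonneg hA0
  simp only [rpow_eq_cfc_of_smul_one_le (hA0 _) (hεA _), rpow_eq_cfc_of_smul_one_le hA₀ hεA₀]
  refine hA.cfc ?_ (fun n => .of_nonneg (hA0 n)) (.of_nonneg hA₀)
  exact (continuous_id.max continuous_const).rpow_const fun r =>
    Or.inl (lt_max_of_lt_right hε).ne'

/-- The solution map is jointly sequentially continuous along sequences with convergent roots. -/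
theorem solMap {f : ℝ≥0 → ℝ≥0} (hf : Continuous (Function.invFun f)) (hB0 : ∀ n, 0 ≤ B n)
    (hS : SOTTendsto (fun n => CFC.sqrt (A n)) (CFC.sqrt A₀))
    (hR : SOTTendsto (fun n => CFC.rpow (A n) (-(1 / 2) : ℝ)) (CFC.rpow A₀ (-(1 / 2) : ℝ)))
    (hB : SOTTendsto B B₀) :
    SOTTendsto (fun n => _root_.solMap f (A n) (B n)) (_root_.solMap f A₀ B₀) :=
  (hS.mul (((hR.mul hB).mul hR).cfc_nnreal hf fun n =>
    (IsSelfAdjoint.of_nonneg rpow_neg_half_nonneg).conjugate_nonneg (hB0 n))).mul hS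

end SOTTendsto

/-- If the representing function `f` of a connection is unbounded
and `f(0) = 0`, then for each `A > 0` and `B ≥ 0` the equation `A σ X = B` has the
unique positive solution `solMap f A B`, and the solution map is separately
sequentially continuous in the strong operator topology on norm-bounded sets. -/
theorem solution_map_continuous [Nontrivial H]
    (σ : (H →L[ℂ] H) → (H →L[ℂ] H) → (H →L[ℂ] H)) (hσ : IsConnection σ)
    (f : ℝ≥0 → ℝ≥0) (hf : IsRepresentingFunction σ f)
    (hub : ¬ ∃ M : ℝ≥0, ∀ x, f x ≤ M) (h0 : f 0 = 0) :
    -- the equation `A σ X = B` has the unique positive solution `solMap f A B`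
    (∀ A B : H →L[ℂ] H, A.IsPositive → IsUnit A → B.IsPositive →
      (solMap f A B).IsPositive ∧ σ A (solMap f A B) = B ∧
        ∀ X : H →L[ℂ] H, X.IsPositive → σ A X = B → X = solMap f A B) ∧
    -- continuity in the second variable
    (∀ A B : H →L[ℂ] H, A.IsPositive → IsUnit A → B.IsPositive →
      ∀ Bseq : ℕ → H →L[ℂ] H, (∀ n, (Bseq n).IsPositive) →
        (∃ M : ℝ, ∀ n, ‖Bseq n‖ ≤ M) → SOTTendsto Bseq B →
        SOTTendsto (fun n => solMap f A (Bseq n)) (solMap f A B)) ∧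
    -- continuity in the first variable
    (∀ A B : H →L[ℂ] H, A.IsPositive → IsUnit A → B.IsPositive →
      ∀ Aseq : ℕ → H →L[ℂ] H, (∀ n, (Aseq n).IsPositive) →
        (∃ ε c : ℝ, 0 < ε ∧ ε ≤ c ∧
          ∀ n, ε • (1 : H →L[ℂ] H) ≤ Aseq n ∧ Aseq n ≤ c • (1 : H →L[ℂ] H)) →
        SOTTendsto Aseq A →
        SOTTendsto (fun n => solMap f (Aseq n) B) (solMap f A B)) := by
  have hfc := hσ.representing_continuous hf h0
  have hfm := hf.1.strictMono hfc (hσ.representing_monotone hf) hub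
  have hfs := NNReal.surjective_of_continuous_of_unbounded hfc h0 hub
  have hgc := hfm.continuous_invFun hfs
  simp only [← nonneg_iff_isPositive]
  refine ⟨fun A B hA hu hB => ⟨solMap_nonneg f A B, solMap_solves hσ hf h0 hfm hfs hA hu hB⟩, ?_, ?_⟩
  · intro A B _ _ _ Bs hBs _ hlim
    exact SOTTendsto.solMap hgc hBs (SOTTendsto.const _) (SOTTendsto.const _) hlim
  · rintro A B _ _ hB As hAs ⟨ε, c, hε, _, hεc⟩ hlim
    exact SOTTendsto.solMap hgc (fun _ => hB) (hlim.sqrt hAs)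
      (hlim.rpow hε (fun n => (hεc n).1) _) (SOTTendsto.const B)

end
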